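/- Let k be a field, B a unital associative k-algebra, and f : B → k a linear form. Then the kernel of f contains a two-sided ideal of B of finite codimension if and only if there exist n ∈ ℕ, a row vector λ : Fin n → k, a column vector γ : Fin n → k, and a homomorphism of unital k-algebras μ : B → Matrix (Fin n) (Fin n) k such that f(x) = Σ_{i,j} λᵢ · (μ(x))ᵢⱼ · γⱼ for all x ∈ B. -/

import Mathlib

/-- Left multiplication on the quotient of an algebra by a left ideal, as a representation. -/
noncomputable def Submodule.leftMulQuotient {k B : Type*} [Field k] [Ring B] [Algebra k B]
    (I : Submodule k B) (hI : ∀ a : B, ∀ x ∈ I, a * x ∈ I) :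
    B →ₐ[k] Module.End k (B ⧸ I) :=
  AlgHom.ofLinearMap
    { toFun := fun a => I.mapQ I (LinearMap.mulLeft k a) (hI a)
      map_add' := fun a b => by
        ext x
        exact congrArg I.mkQ (add_mul a b x)
      map_smul' := fun c a => by
        ext x
        exact congrArg I.mkQ (smul_mul_assoc c a x) }
    (by
      ext x
      exact congrArg I.mkQ (one_mul x))
    (fun a b => by
      ext x
      exact congrArg I.mkQ (mul_assoc a b x))

theorem Submodule.leftMulQuotient_mk {k B : Type*} [Field k] [Ring B] [Algebra k B]
    (I : Submodule k B) (hI : ∀ a : B, ∀ x ∈ I, a * x ∈ I) (a x : B) :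
    I.leftMulQuotient hI a (I.mkQ x) = I.mkQ (a * x) := rfl

/-- A matrix coefficient of a representation on a finite-dimensional space, in coordinates. -/
theorem LinearMap.apply_eq_sum_toMatrixAlgEquiv {k V : Type*} [Field k] [AddCommGroup V]
    [Module k V] {ι : Type*} [Fintype ι] [DecidableEq ι] (b : Module.Basis ι k V)
    (g : V →ₗ[k] k) (T : Module.End k V) (v : V) :
    g (T v) = ∑ i, ∑ j, g (b i) * LinearMap.toMatrixAlgEquiv b T i j * b.repr v j := by
  have h (i : ι) : b.repr (T v) i = ∑ j, LinearMap.toMatrixAlgEquiv b T i j * b.repr v j :=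
    (congrFun (LinearMap.toMatrix_mulVec_repr b b T v) i).symm
  conv_lhs => rw [← b.sum_repr (T v)]
  simp only [map_sum, map_smul, smul_eq_mul, h, Finset.sum_mul]
  exact Finset.sum_congr rfl fun i _ => Finset.sum_congr rfl fun j _ => by ring


/-- Let `k` be a field, `B` a unital associative `k`-algebra and
`f : B → k` a linear form.  Then `ker f` contains a two-sided ideal of finite codimension
iff there exist `n`, a row `λ`, a column `γ` and a homomorphism of unital `k`-algebras
`μ : B →ₐ[k] k^{n×n}` with `f x = ∑ i j, λ i * (μ x) i j * γ j` for all `x`. -/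
theorem finite_codim_two_sided_ideal_iff_matrix_algebra_representation
    {k B : Type*} [Field k] [Ring B] [Algebra k B] (f : B →ₗ[k] k) :
    (∃ I : Submodule k B,
      (∀ a : B, ∀ x ∈ I, a * x ∈ I) ∧ (∀ a : B, ∀ x ∈ I, x * a ∈ I) ∧
      I ≤ LinearMap.ker f ∧ FiniteDimensional k (B ⧸ I)) ↔
    (∃ (n : ℕ) (lam gam : Fin n → k) (μ : B →ₐ[k] Matrix (Fin n) (Fin n) k),
      ∀ x : B, f x = ∑ i, ∑ j, lam i * μ x i j * gam j) := by
  constructor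
  · rintro ⟨I, hleft, -, hker, hfin⟩
    let b := Module.finBasis k (B ⧸ I)
    let g := I.liftQ f hker
    refine ⟨_, fun i => g (b i), b.repr (I.mkQ 1),
      (LinearMap.toMatrixAlgEquiv b).toAlgHom.comp (I.leftMulQuotient hleft), fun x => ?_⟩
    refine Eq.trans ?_
      (LinearMap.apply_eq_sum_toMatrixAlgEquiv b g (I.leftMulQuotient hleft x) (I.mkQ 1))
    rw [Submodule.leftMulQuotient_mk, mul_one]
    rfl
  · rintro ⟨n, lam, gam, μ, h⟩
    refine ⟨LinearMap.ker μ.toLinearMap, fun a x hx => ?_, fun a x hx => ?_, fun x hx => ?_,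
      Module.Finite.equiv μ.toLinearMap.quotKerEquivRange.symm⟩
    all_goals have hx : μ x = 0 := hx
    · simp [hx]
    · simp [hx]
    · simp [h, hx]
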